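/- Let φ be a Jacob's ladder on [T₀,∞) with k₁T ≤ φ(T) ≤ k₂T for all T ≥ T₀ (for some constants 0 < k₁ ≤ k₂), satisfying ln(φ(T)/2) = ln T + O(1/ln T) as T → ∞, and assume the Balasubramanian formula: for every ε > 0, ∫₀^T Z(t)² dt = T ln T + (2c − 1 − ln 2π)T + O(T^{1/3+ε}) as T → ∞. Fix ε > 0. Suppose γ and γ̄ are zeros of ζ(1/2+it) with γ̄ = γ + γ^{1/3+2ε} + Δ(γ), 0 ≤ Δ(γ) = O(γ^{1/4+ε}). Then, as γ → ∞, uniformly over all subintervals [N, M] ⊆ [γ, γ̄] with N < M whose chord of the curve y = φ(t)/2 is parallel to the chord over [γ, γ̄], i.e. [φ(M) − φ(N)]/(M − N) = [φ(γ̄) − φ(γ)]/(γ̄ − γ), one has ∫_N^M Z(t)² dt = (M−N)·ln N + (2c − ln 2π)·(M−N) + O((M−N)/ln γ) + O(γ^{−(1/3−4ε)}). -/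

import Mathlib

open Real MeasureTheory Filter

/-- `Z(t)²`, i.e. `|ζ(1/2 + it)|²`. -/
noncomputable def Z2 (t : ℝ) : ℝ := ‖riemannZeta (1/2 + Complex.I * t)‖ ^ 2

/-- The constant `a = ln(2π) − 1 − c`, where `c` is the Euler–Mascheroni constant. -/
noncomputable def aConst : ℝ := Real.log (2 * Real.pi) - 1 - Real.eulerMascheroniConstant

lemma continuous_Z2 : Continuous Z2 := by
  have h : ∀ t : ℝ, ContinuousAt (fun t : ℝ => riemannZeta (1/2 + Complex.I * t)) t := by
    intro t
    have hne : (1/2 + Complex.I * t : ℂ) ≠ 1 := by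
      intro h
      have := congrArg Complex.re h
      norm_num at this
    exact ContinuousAt.comp (f := fun t : ℝ => (1/2 + Complex.I * t : ℂ))
      (differentiableAt_riemannZeta hne).continuousAt (by fun_prop)
  exact (continuous_iff_continuousAt.2 h).norm.pow 2

lemma integral_Z2_sub (N M : ℝ) :
    (∫ t in N..M, Z2 t) = (∫ t in (0:ℝ)..M, Z2 t) - ∫ t in (0:ℝ)..N, Z2 t :=
  (intervalIntegral.integral_interval_sub_left (continuous_Z2.intervalIntegrable _ _)
    (continuous_Z2.intervalIntegrable _ _)).symm

lemma mul_log_sub_tangent_nonneg {x y : ℝ} (hx : 0 < x) (hy : 0 < y) :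
    0 ≤ y * log y - x * log x - (y - x) * (log x + 1) := by
  have h := Real.log_le_sub_one_of_pos (div_pos hx hy)
  rw [Real.log_div hx.ne' hy.ne'] at h
  have h2 := mul_le_mul_of_nonneg_left h hy.le
  have h3 : y * (x / y - 1) = x - y := by field_simp
  nlinarith

lemma mul_log_sub_tangent_le {x y : ℝ} (hx : 0 < x) (hy : 0 < y) :
    y * log y - x * log x - (y - x) * (log x + 1) ≤ (y - x) ^ 2 / x := by
  have h := Real.log_le_sub_one_of_pos (div_pos hy hx)
  rw [Real.log_div hy.ne' hx.ne'] at h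
  have h2 := mul_le_mul_of_nonneg_left h hy.le
  have h3 : y * (y / x - 1) = (y - x) ^ 2 / x + (y - x) := by field_simp; ring
  nlinarith

/-- Increments of a function close to `T log T + (b - 1) T`. -/
lemma abs_increment_le {F : ℝ → ℝ} {b C e T₁ N M : ℝ} (he : 0 ≤ e)
    (h : ∀ T ≥ T₁, |F T - T * log T - (b - 1) * T| ≤ C * T ^ e)
    (hT : T₁ ≤ N) (hN : 0 < N) (hNM : N ≤ M) :
    |F M - F N - ((M - N) * log N + b * (M - N))|
      ≤ (M - N) ^ 2 / N + 2 * |C| * M ^ e := by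
  have hM : 0 < M := hN.trans_le hNM
  have h1 := abs_le.1 (h N hT)
  have h2 := abs_le.1 (h M (hT.trans hNM))
  have h3 := mul_log_sub_tangent_nonneg hN hM
  have h4 := mul_log_sub_tangent_le hN hM
  have h5 : N ^ e ≤ M ^ e := Real.rpow_le_rpow hN.le hNM he
  have h6 : C * N ^ e ≤ |C| * M ^ e :=
    mul_le_mul (le_abs_self C) h5 (Real.rpow_nonneg hN.le e) (abs_nonneg C)
  have h7 : C * M ^ e ≤ |C| * M ^ e :=
    mul_le_mul_of_nonneg_right (le_abs_self C) (Real.rpow_nonneg hM.le e)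
  have h8 : 0 ≤ (M - N) ^ 2 / N := by positivity
  rw [abs_le]
  constructor <;> nlinarith

/-- Increments of `x log x + q x` in terms of an approximate value `L` of the logarithm. -/
lemma abs_mul_log_increment_le {x y L d q c₀ FN FM e : ℝ} (hx : 0 < x) (hxy : x ≤ y)
    (hxL : |log x - L| ≤ d) (hyL : |log y - L| ≤ d)
    (hN : |FN - x * log x - q * x - c₀| ≤ e) (hM : |FM - y * log y - q * y - c₀| ≤ e) :
    |FM - FN - (y - x) * (L + 1 + q)| ≤ (y - x) * d + 2 * e := by
  have hy : 0 < y := hx.trans_le hxy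
  have h1 := mul_log_sub_tangent_nonneg hx hy
  have h2 := mul_log_sub_tangent_nonneg hy hx
  have hN := abs_le.1 hN
  have hM := abs_le.1 hM
  have h3 := mul_le_mul_of_nonneg_left (abs_le.1 hxL).1 (sub_nonneg.2 hxy)
  have h4 := mul_le_mul_of_nonneg_left (abs_le.1 hyL).2 (sub_nonneg.2 hxy)
  rw [abs_le]
  constructor <;> nlinarith

/-- Transfers the mean value over a long interval to a subinterval with parallel chord. -/
lemma abs_sub_le_of_common_slope {I J U D k L A b C₁ C₃ C₅ w l : ℝ}
    (hU : 0 < U) (hD : 0 ≤ D) (hk : 0 ≤ k) (hC₁ : 0 ≤ C₁) (hC₃ : 0 ≤ C₃) (hC₅ : 0 ≤ C₅)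
    (hL : 1 ≤ L) (hLA : 4 * (|A| + C₁) ≤ L) (hLb : |b| + C₃ + C₅ ≤ L)
    (hw : w ≤ U * (1 / L)) (hl : |l - L| ≤ 1 / L)
    (hI : |I - k * D * (L + A)| ≤ k * D * (C₁ / L) + C₃ * w)
    (hJ : |J - k * U * (L + A)| ≤ k * U * (C₁ / L) + C₃ * w)
    (hJ' : |J - U * (L + b)| ≤ C₅ * (U * (1 / L))) :
    |I - (D * l + b * D)| ≤ (8 * C₁ + C₃ + C₅ + 1) * (D / L) + C₃ * w := by
  have hL0 : 0 < L := by linarith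
  obtain ⟨r, hr⟩ : ∃ r, r = 1 / L := ⟨_, rfl⟩
  have hr0 : 0 ≤ r := by rw [hr]; positivity
  have hr1 : r ≤ 1 := by rw [hr, div_le_one hL0]; exact hL
  have e1 : C₁ / L = C₁ * r := by rw [hr]; ring
  have e2 : D / L = D * r := by rw [hr]; ring
  rw [e1] at hI hJ
  rw [← hr] at hw hl hJ'
  rw [e2]
  have hJ1 := abs_le.1 hJ
  have hJ2 := abs_le.1 hJ'
  have hI1 := abs_le.1 hI
  have hw3 : C₃ * w ≤ C₃ * (U * r) := mul_le_mul_of_nonneg_left hw hC₃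
  have hk1 : k * (L + A) - (L + b) ≤ (k * C₁ + C₃ + C₅) * r := by
    refine le_of_mul_le_mul_left ?_ hU
    linarith
  have hk2 : -((k * C₁ + C₃ + C₅) * r) ≤ k * (L + A) - (L + b) := by
    refine le_of_mul_le_mul_left ?_ hU
    linarith
  have hk4 : k ≤ 4 := by
    by_contra! hlt
    have hA := (abs_le.1 (le_refl |A|)).1
    have hb := le_abs_self b
    have i1 : k * C₁ * r ≤ k * C₁ := mul_le_of_le_one_right (by positivity) hr1
    have i2 : (C₃ + C₅) * r ≤ C₃ + C₅ := mul_le_of_le_one_right (by positivity) hr1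
    have i3 : k * (L - |A| - C₁) ≤ 2 * L := by nlinarith
    have i4 : L * (3 / 4) ≤ L - |A| - C₁ := by linarith
    nlinarith
  have hkC : k * C₁ * r ≤ 4 * (C₁ * r) := by
    have : 0 ≤ C₁ * r := by positivity
    nlinarith
  have hb1 : |k * (L + A) - (L + b)| ≤ (4 * C₁ + C₃ + C₅) * r := by
    rw [abs_le]; constructor <;> linarith
  have hb1 := abs_le.1 hb1
  have hl1 := abs_le.1 hl
  have j1 := mul_le_mul_of_nonneg_left hb1.1 hD
  have j2 := mul_le_mul_of_nonneg_left hb1.2 hD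
  have j3 := mul_le_mul_of_nonneg_left hl1.1 hD
  have j4 := mul_le_mul_of_nonneg_left hl1.2 hD
  have j5 := mul_le_mul_of_nonneg_left hkC hD
  rw [abs_le]
  constructor <;> linarith

lemma eventually_mul_log_le_rpow (K : ℝ) {s : ℝ} (hs : 0 < s) :
    ∀ᶠ x : ℝ in atTop, K * log x ≤ x ^ s := by
  have h := (isLittleO_log_rpow_atTop hs).bound (c := 1 / (|K| + 1)) (by positivity)
  filter_upwards [h, eventually_ge_atTop 1] with x hx hx1
  have hlog := Real.log_nonneg hx1
  rw [Real.norm_of_nonneg hlog, Real.norm_of_nonneg (by positivity), one_div,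
    inv_mul_eq_div, le_div_iff₀ (by positivity)] at hx
  nlinarith [le_abs_self K]

set_option maxHeartbeats 1000000 in
theorem parallel_chords_between_zeros
    (φ : ℝ → ℝ) (T₀ : ℝ)
    (hcont : ContinuousOn φ (Set.Ici T₀))
    (hmono : StrictMonoOn φ (Set.Ici T₀))
    (hpos : ∀ T ≥ T₀, 0 < φ T)
    (hladder : ∃ c₀ C : ℝ, ∀ T ≥ T₀,
      |(∫ t in (0:ℝ)..T, Z2 t) - (φ T / 2) * Real.log (φ T / 2)
        - (Real.eulerMascheroniConstant - Real.log (2 * Real.pi)) * (φ T / 2) - c₀|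
        ≤ C * Real.log T / T)
    (k₁ k₂ : ℝ) (hk₁ : 0 < k₁) (hk₁₂ : k₁ ≤ k₂)
    (hgrowth : ∀ T ≥ T₀, k₁ * T ≤ φ T ∧ φ T ≤ k₂ * T)
    (hlog : ∃ C T₁ : ℝ, ∀ T ≥ T₁,
      |Real.log (φ T / 2) - Real.log T| ≤ C / Real.log T)
    (hBal : ∀ ε > (0:ℝ), ∃ C T₁ : ℝ, ∀ T ≥ T₁,
      |(∫ t in (0:ℝ)..T, Z2 t) - T * Real.log T
        - (2 * Real.eulerMascheroniConstant - 1 - Real.log (2 * Real.pi)) * T|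
        ≤ C * T ^ ((1:ℝ)/3 + ε))
    (ε : ℝ) (hε : 0 < ε)
    (Δ : ℝ → ℝ) (hΔ0 : ∀ γ, 0 ≤ Δ γ)
    (hΔO : ∃ C Γ : ℝ, ∀ γ ≥ Γ, Δ γ ≤ C * γ ^ ((1:ℝ)/4 + ε)) :
    ∃ C Γ : ℝ, ∀ γ ≥ Γ, riemannZeta (1/2 + Complex.I * γ) = 0 →
      riemannZeta (1/2 + Complex.I * ((γ + γ ^ ((1:ℝ)/3 + 2*ε) + Δ γ : ℝ) : ℂ)) = 0 →
      ∀ N M : ℝ, γ ≤ N → N < M → M ≤ γ + γ ^ ((1:ℝ)/3 + 2*ε) + Δ γ →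
      (φ M - φ N) / (M - N)
        = (φ (γ + γ ^ ((1:ℝ)/3 + 2*ε) + Δ γ) - φ γ) / (γ ^ ((1:ℝ)/3 + 2*ε) + Δ γ) →
      |(∫ t in N..M, Z2 t)
        - ((M - N) * Real.log N
          + (2 * Real.eulerMascheroniConstant - Real.log (2 * Real.pi)) * (M - N))|
        ≤ C * ((M - N) / Real.log γ + γ ^ (-((1:ℝ)/3 - 4*ε))) := by
  obtain ⟨CΔ, ΓΔ, hΔ⟩ := hΔO
  set F : ℝ → ℝ := fun T => ∫ t in (0:ℝ)..T, Z2 t with hF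
  set b : ℝ := 2 * Real.eulerMascheroniConstant - Real.log (2 * Real.pi) with hb
  set p : ℝ := (1:ℝ)/3 + 2 * ε with hp
  have hp0 : 0 < p := by positivity
  set K : ℝ := 1 + |CΔ| with hK
  have hK1 : 1 ≤ K := by have := abs_nonneg CΔ; linarith
  have hUle : ∀ γ : ℝ, 1 ≤ γ → ΓΔ ≤ γ → γ ^ p + Δ γ ≤ K * γ ^ p := by
    intro γ h1 h2
    have h3 : γ ^ ((1:ℝ)/4 + ε) ≤ γ ^ p := Real.rpow_le_rpow_of_exponent_le h1 (by linarith)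
    have h4 : CΔ * γ ^ ((1:ℝ)/4 + ε) ≤ |CΔ| * γ ^ p :=
      mul_le_mul (le_abs_self _) h3 (by positivity) (abs_nonneg _)
    have := hΔ γ h2
    linarith
  by_cases hε3 : (1:ℝ)/3 ≤ ε
  · obtain ⟨C, T₁, hB⟩ := hBal (1/3) (by norm_num)
    have hB' : ∀ T ≥ T₁, |F T - T * log T - (b - 1) * T| ≤ C * T ^ ((1:ℝ)/3 + 1/3) := by
      intro T hT
      have := hB T hT
      rwa [show (2 * Real.eulerMascheroniConstant - 1 - Real.log (2 * Real.pi)) = b - 1 by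
        rw [hb]; ring] at this
    refine ⟨K ^ 2 + 2 * |C| * (1 + K) ^ ((1:ℝ)/3 + 1/3), max (max 1 ΓΔ) T₁, ?_⟩
    intro γ hγ _ _ N M hγN hNM hM _
    have hγ1 : 1 ≤ γ := (le_max_left _ _).trans ((le_max_left _ _).trans hγ)
    have hγΔ : ΓΔ ≤ γ := (le_max_right _ _).trans ((le_max_left _ _).trans hγ)
    have hγT : T₁ ≤ γ := (le_max_right _ _).trans hγ
    have hγ0 : 0 < γ := by linarith
    have hU := hUle γ hγ1 hγΔ
    rw [integral_Z2_sub]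
    refine (abs_increment_le (by norm_num) hB' (hγT.trans hγN) (hγ0.trans_le hγN) hNM.le).trans ?_
    set X : ℝ := γ ^ (-((1:ℝ)/3 - 4 * ε)) with hX
    have hX0 : 0 < X := Real.rpow_pos_of_pos hγ0 _
    have hsq : (M - N) ^ 2 / N ≤ K ^ 2 * X := by
      have h1 : (M - N) ^ 2 ≤ (K * γ ^ p) ^ 2 :=
        pow_le_pow_left₀ (by linarith) (by linarith) 2
      have h2 : (M - N) ^ 2 / N ≤ (K * γ ^ p) ^ 2 / γ :=
        div_le_div₀ (by positivity) h1 hγ0 hγN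
      have h3 : (γ ^ p) ^ 2 / γ = X := by
        rw [← Real.rpow_natCast, ← Real.rpow_mul hγ0.le]
        nth_rewrite 2 [← Real.rpow_one γ]
        rw [← Real.rpow_sub hγ0, hX, hp]
        congr 1
        push_cast
        ring
      calc _ ≤ _ := h2
        _ = K ^ 2 * ((γ ^ p) ^ 2 / γ) := by ring
        _ = _ := by rw [h3]
    have hMe : M ^ ((1:ℝ)/3 + 1/3) ≤ (1 + K) ^ ((1:ℝ)/3 + 1/3) * X := by
      have h1 : γ ≤ γ ^ p := by
        have := Real.rpow_le_rpow_of_exponent_le hγ1 (show (1:ℝ) ≤ p by linarith)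
        rwa [Real.rpow_one] at this
      have h2 : M ≤ (1 + K) * γ ^ p := by linarith
      have h3 : M ^ ((1:ℝ)/3 + 1/3) ≤ ((1 + K) * γ ^ p) ^ ((1:ℝ)/3 + 1/3) :=
        Real.rpow_le_rpow (by linarith) h2 (by norm_num)
      refine h3.trans ?_
      rw [Real.mul_rpow (by linarith) (by positivity), ← Real.rpow_mul hγ0.le]
      refine mul_le_mul_of_nonneg_left ?_ (Real.rpow_nonneg (by linarith) _)
      exact Real.rpow_le_rpow_of_exponent_le hγ1 (by rw [hp]; linarith)
    have hA : 0 ≤ 2 * |C| := by positivity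
    have hMe' := mul_le_mul_of_nonneg_left hMe hA
    have hE : 0 ≤ (1 + K) ^ ((1:ℝ)/3 + 1/3) := Real.rpow_nonneg (by linarith) _
    have hpos' : 0 ≤ (K ^ 2 + 2 * |C| * (1 + K) ^ ((1:ℝ)/3 + 1/3)) * ((M - N) / log γ) := by
      have := Real.log_nonneg hγ1
      have : 0 ≤ M - N := by linarith
      positivity
    linarith
  · push Not at hε3
    have hp1 : p < 1 := by linarith
    obtain ⟨CB, TB, hB⟩ := hBal ε hε
    have hB' : ∀ T ≥ TB, |F T - T * log T - (b - 1) * T| ≤ CB * T ^ ((1:ℝ)/3 + ε) := by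
      intro T hT
      have := hB T hT
      rwa [show (2 * Real.eulerMascheroniConstant - 1 - Real.log (2 * Real.pi)) = b - 1 by
        rw [hb]; ring] at this
    obtain ⟨Cl, Tl, hl⟩ := hlog
    obtain ⟨c₀, C₂, hlad⟩ := hladder
    set q : ℝ := Real.eulerMascheroniConstant - Real.log (2 * Real.pi) with hq
    set C₁ : ℝ := |Cl| + 1 with hC₁
    set C₃ : ℝ := 4 * |C₂| with hC₃
    set C₅ : ℝ := 1 + 4 * |CB| with hC₅
    have hC₁0 : 0 ≤ C₁ := by positivity
    have hC₃0 : 0 ≤ C₃ := by positivity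
    have hC₅0 : 0 ≤ C₅ := by positivity
    have hev : ∀ᶠ γ : ℝ in atTop, (1 ≤ γ ∧ ΓΔ ≤ γ ∧ TB ≤ γ ∧ Tl ≤ γ ∧ T₀ ≤ γ) ∧
        (1 ≤ log γ ∧ 4 * (|1 + q| + C₁) ≤ log γ ∧ |b| + C₃ + C₅ ≤ log γ) ∧
        K * log γ ≤ γ ^ (1 - p) ∧ 1 * log γ ≤ γ ^ ε ∧ 1 * log γ ≤ γ ^ ((1:ℝ)/2) ∧
        1 * log γ ≤ γ ^ ((2:ℝ)/3 + 4 * ε) := by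
      filter_upwards [eventually_ge_atTop 1, eventually_ge_atTop ΓΔ, eventually_ge_atTop TB,
        eventually_ge_atTop Tl, eventually_ge_atTop T₀,
        Real.tendsto_log_atTop.eventually_ge_atTop 1,
        Real.tendsto_log_atTop.eventually_ge_atTop (4 * (|1 + q| + C₁)),
        Real.tendsto_log_atTop.eventually_ge_atTop (|b| + C₃ + C₅),
        eventually_mul_log_le_rpow K (show 0 < 1 - p by linarith),
        eventually_mul_log_le_rpow 1 hε,
        eventually_mul_log_le_rpow 1 (show (0:ℝ) < 1 / 2 by norm_num),
        eventually_mul_log_le_rpow 1 (show (0:ℝ) < 2 / 3 + 4 * ε by positivity)]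
        with γ h1 h2 h3 h4 h5 h6 h7 h8 h9 h10 h11 h12
      exact ⟨⟨h1, h2, h3, h4, h5⟩, ⟨h6, h7, h8⟩, h9, h10, h11, h12⟩
    obtain ⟨Γ, hΓ⟩ := eventually_atTop.1 hev
    refine ⟨8 * C₁ + C₃ + C₅ + 1, Γ, ?_⟩
    intro γ hγ _ _ N M hγN hNM hM hchord
    obtain ⟨⟨hγ1, hγΔ, hγB, hγl, hγ₀⟩, ⟨hL1, hLA, hLb⟩, hKL, hLε, hLh, hLX⟩ := hΓ γ hγ
    have hγ0 : 0 < γ := by linarith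
    set L : ℝ := log γ with hL
    have hL0 : 0 < L := by linarith
    rw [one_mul] at hLε hLh hLX
    have hUK := hUle γ hγ1 hγΔ
    set U : ℝ := γ ^ p + Δ γ with hUdef
    have hUp : γ ^ p ≤ U := by have := hΔ0 γ; linarith
    have hγp : 1 ≤ γ ^ p := Real.one_le_rpow hγ1 hp0.le
    have hU0 : 0 < U := by linarith
    rw [add_assoc, ← hUdef] at hM hchord
    have hUL : U * L ≤ γ := by
      calc U * L ≤ K * γ ^ p * L := mul_le_mul_of_nonneg_right hUK hL0.le
        _ = γ ^ p * (K * L) := by ring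
        _ ≤ γ ^ p * γ ^ (1 - p) := mul_le_mul_of_nonneg_left hKL (by positivity)
        _ = γ := by rw [← Real.rpow_add hγ0]; simp
    have hUγ : U / γ ≤ 1 / L := by
      rw [div_le_div_iff₀ hγ0 hL0]; linarith
    have hUγ' : U ≤ γ := by nlinarith
    have hlogx : ∀ x, γ ≤ x → x ≤ γ + U → L ≤ log x ∧ log x - L ≤ 1 / L := by
      intro x h1 h2
      refine ⟨Real.log_le_log hγ0 h1, ?_⟩
      have h3 := Real.log_le_sub_one_of_pos (div_pos (hγ0.trans_le h1) hγ0)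
      rw [Real.log_div (hγ0.trans_le h1).ne' hγ0.ne'] at h3
      have h4 : x / γ ≤ (γ + U) / γ := by gcongr
      rw [add_div, div_self hγ0.ne'] at h4
      linarith
    have hrL : 1 / L ≤ 1 := by rw [div_le_one hL0]; exact hL1
    have hψ : ∀ x, γ ≤ x → x ≤ γ + U → |log (φ x / 2) - L| ≤ C₁ / L := by
      intro x h1 h2
      obtain ⟨h3, h4⟩ := hlogx x h1 h2
      have h5 := hl x (hγl.trans h1)
      have h6 : Cl / log x ≤ |Cl| / L :=
        div_le_div₀ (abs_nonneg _) (le_abs_self _) hL0 h3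
      have h7 : C₁ / L = |Cl| / L + 1 / L := by rw [hC₁]; ring
      have h8 := abs_le.1 (h5.trans h6)
      have h9 : 0 ≤ 1 / L := by positivity
      rw [h7, abs_le]
      constructor <;> linarith
    have hlade : ∀ x, γ ≤ x → x ≤ γ + U →
        |F x - (φ x / 2) * log (φ x / 2) - q * (φ x / 2) - c₀| ≤ 2 * |C₂| * (L / γ) := by
      intro x h1 h2
      obtain ⟨h3, h4⟩ := hlogx x h1 h2
      refine (hlad x (hγ₀.trans h1)).trans ?_
      have h5 : C₂ * log x ≤ |C₂| * (2 * L) :=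
        mul_le_mul (le_abs_self _) (by linarith) (by linarith) (abs_nonneg _)
      have h6 : C₂ * log x / x ≤ |C₂| * (2 * L) / γ :=
        div_le_div₀ (by positivity) h5 hγ0 h1
      calc _ ≤ _ := h6
        _ = _ := by ring
    have hinc : ∀ x y, γ ≤ x → x ≤ y → y ≤ γ + U →
        |F y - F x - (φ y / 2 - φ x / 2) * (L + 1 + q)|
          ≤ (φ y / 2 - φ x / 2) * (C₁ / L) + C₃ * (L / γ) := by
      intro x y h1 h2 h3
      have h4 : φ x ≤ φ y :=
        hmono.monotoneOn (hγ₀.trans h1) (hγ₀.trans (h1.trans h2)) h2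
      have h5 := hpos x (hγ₀.trans h1)
      refine (abs_mul_log_increment_le (by linarith) (by linarith) (hψ x h1 (h2.trans h3))
        (hψ y (h1.trans h2) h3) (hlade x h1 (h2.trans h3))
        (hlade y (h1.trans h2) h3)).trans (le_of_eq ?_)
      rw [hC₃]; ring
    set k : ℝ := (φ (γ + U) - φ γ) / U / 2 with hk
    have hk0 : 0 ≤ k := by
      have : φ γ ≤ φ (γ + U) :=
        hmono.monotoneOn hγ₀ (show T₀ ≤ γ + U by linarith) (by linarith)
      have : 0 ≤ φ (γ + U) - φ γ := by linarith
      positivity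
    have hkU : φ (γ + U) / 2 - φ γ / 2 = k * U := by rw [hk]; field_simp
    have hkD : φ M / 2 - φ N / 2 = k * (M - N) := by
      have : M - N ≠ 0 := by linarith
      rw [hk, ← hchord]; field_simp
    have hI := hinc N M hγN hNM.le hM
    have hJ := hinc γ (γ + U) le_rfl (by linarith) le_rfl
    rw [hkD, add_assoc] at hI
    rw [hkU, add_assoc] at hJ
    have hJ' : |F (γ + U) - F γ - U * (L + b)| ≤ C₅ * (U * (1 / L)) := by
      have h := abs_increment_le (by positivity) hB' hγB hγ0 (show γ ≤ γ + U by linarith)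
      rw [add_sub_cancel_left] at h
      rw [show U * (L + b) = U * log γ + b * U by rw [← hL]; ring]
      refine h.trans ?_
      have h1 : U ^ 2 / γ ≤ U * (1 / L) := by
        calc U ^ 2 / γ = U * (U / γ) := by ring
          _ ≤ _ := mul_le_mul_of_nonneg_left hUγ hU0.le
      have h2 : (γ + U) ^ ((1:ℝ)/3 + ε) ≤ 2 * γ ^ ((1:ℝ)/3 + ε) := by
        calc (γ + U) ^ ((1:ℝ)/3 + ε) ≤ (2 * γ) ^ ((1:ℝ)/3 + ε) :=
              Real.rpow_le_rpow (by linarith) (by linarith) (by positivity)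
          _ = 2 ^ ((1:ℝ)/3 + ε) * γ ^ ((1:ℝ)/3 + ε) := Real.mul_rpow (by norm_num) hγ0.le
          _ ≤ 2 * γ ^ ((1:ℝ)/3 + ε) := by
              refine mul_le_mul_of_nonneg_right ?_ (by positivity)
              have := Real.rpow_le_rpow_of_exponent_le (show (1:ℝ) ≤ 2 by norm_num)
                (show (1:ℝ)/3 + ε ≤ 1 by linarith)
              rwa [Real.rpow_one] at this
      have h3 : γ ^ ((1:ℝ)/3 + ε) ≤ U * (1 / L) := by
        rw [mul_one_div, le_div_iff₀ hL0]
        calc γ ^ ((1:ℝ)/3 + ε) * L ≤ γ ^ ((1:ℝ)/3 + ε) * γ ^ ε :=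
              mul_le_mul_of_nonneg_left hLε (by positivity)
          _ = γ ^ p := by rw [← Real.rpow_add hγ0, hp]; congr 1; ring
          _ ≤ U := hUp
      have h4 : 2 * |CB| * (γ + U) ^ ((1:ℝ)/3 + ε) ≤ 2 * |CB| * (2 * (U * (1 / L))) :=
        mul_le_mul_of_nonneg_left (by linarith) (by positivity)
      rw [hC₅]
      linarith
    have hw : L / γ ≤ U * (1 / L) := by
      have h1 : L * L ≤ γ := by
        calc L * L ≤ γ ^ ((1:ℝ)/2) * γ ^ ((1:ℝ)/2) := mul_le_mul hLh hLh hL0.le (by positivity)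
          _ = γ := by rw [← Real.rpow_add hγ0]; norm_num
      have h2 : L / γ ≤ 1 / L := by rw [div_le_div_iff₀ hγ0 hL0]; linarith
      have h3 : 0 ≤ 1 / L := by positivity
      nlinarith
    obtain ⟨hN1, hN2⟩ := hlogx N hγN (by linarith)
    have hlN : |log N - L| ≤ 1 / L := by rwa [abs_of_nonneg (by linarith)]
    have hfin := abs_sub_le_of_common_slope hU0 (show 0 ≤ M - N by linarith) hk0 hC₁0 hC₃0 hC₅0
      hL1 hLA hLb hw hlN hI hJ hJ'
    rw [integral_Z2_sub]
    refine hfin.trans ?_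
    have hwX : L / γ ≤ γ ^ (-((1:ℝ)/3 - 4 * ε)) := by
      rw [div_le_iff₀ hγ0]
      calc L ≤ γ ^ ((2:ℝ)/3 + 4 * ε) := hLX
        _ = γ ^ (-((1:ℝ)/3 - 4 * ε) + 1) := by congr 1; ring
        _ = _ := by rw [Real.rpow_add hγ0, Real.rpow_one]
    have hC : C₃ ≤ 8 * C₁ + C₃ + C₅ + 1 := by linarith
    have hwX' := mul_le_mul hC hwX (by positivity) (by linarith)
    rw [mul_add (8 * C₁ + C₃ + C₅ + 1)]
    linarith only [hwX']
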